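/- Let R_res = B(1,2)·B(3,4)·B(2,3)·B(4,3)·B(2,1) be the residual beam-splitter network matrix of the modified bilayer square lattice. Then there do not exist θ, θ' : {1,2,3,4} → ℝ with all components in (−π/2, π/2] and θ not constant, and a 4×4 real orthogonal matrix R', such that, as complex matrices, diag(e^{iθ₁},…,e^{iθ₄}) · R_res = R' · diag(e^{iθ'₁},…,e^{iθ'₄}). In other words, the residual network cannot be cancelled by any nontrivial choice of homodyne measurement angles together with an orthogonal post-processing of outcomes. -/

import Mathlib

open Matrix

/-- The 4×4 real balanced beam-splitter matrix `B(j,k)` (modes labelled by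
`Fin 4`, so mode `n` of the paper is index `n - 1`): it agrees with the identity
except in rows and columns `j` and `k`, where
`B jj = B kk = 1/√2`, `B jk = −1/√2`, `B kj = 1/√2`. -/
noncomputable def Bsplit (j k : Fin 4) : Matrix (Fin 4) (Fin 4) ℝ :=
  fun a b =>
    if a = j then (if b = j then 1 / Real.sqrt 2 else if b = k then -(1 / Real.sqrt 2) else 0)
    else if a = k then (if b = j then 1 / Real.sqrt 2 else if b = k then 1 / Real.sqrt 2 else 0)
    else if b = a then 1 else 0

/-- The residual beam-splitter network matrix of the modified bilayer square
lattice: `R_res = B(1,2)·B(3,4)·B(2,3)·B(4,3)·B(2,1)` (modes 1,2,3,4 being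
indices 0,1,2,3). -/
noncomputable def Rres : Matrix (Fin 4) (Fin 4) ℝ :=
  Bsplit 0 1 * Bsplit 2 3 * Bsplit 1 2 * Bsplit 3 2 * Bsplit 1 0

/-- Every entry of the first column of `Rres` is nonzero. -/
lemma Rres_apply_zero_ne_zero (j : Fin 4) : Rres j 0 ≠ 0 := by
  have hpos : 0 < (√2 : ℝ)⁻¹ := by positivity
  have hsq : (√2 : ℝ)⁻¹ * (√2)⁻¹ = 1 / 2 := by
    rw [← mul_inv, Real.mul_self_sqrt (by norm_num)]; norm_num
  have hlt : (√2 : ℝ)⁻¹ < 1 := by nlinarith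
  fin_cases j <;>
    simp [Rres, Bsplit, Matrix.mul_apply, Fin.sum_univ_four] <;>
    generalize (√2 : ℝ)⁻¹ = s at * <;>
    intro h <;> nlinarith

/-- If a nonzero real number stays real after the phase change `e^{iα}` to `e^{iβ}`, with
both angles in `(-π/2, π/2]`, then the angles coincide. -/
lemma eq_of_exp_mul_ofReal_eq {α β r r' : ℝ}
    (hα : α ∈ Set.Ioc (-(Real.pi / 2)) (Real.pi / 2))
    (hβ : β ∈ Set.Ioc (-(Real.pi / 2)) (Real.pi / 2)) (hr : r ≠ 0)
    (h : Complex.exp ((α : ℂ) * Complex.I) * r = r' * Complex.exp ((β : ℂ) * Complex.I)) :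
    α = β := by
  have hre := congrArg Complex.re h
  have him := congrArg Complex.im h
  simp [Complex.exp_ofReal_mul_I_re, Complex.exp_ofReal_mul_I_im] at hre him
  have hsin : Real.sin (α - β) = 0 := by
    rw [Real.sin_sub]
    apply mul_right_cancel₀ hr
    linear_combination Real.cos β * him - Real.sin β * hre
  have := (Real.sin_eq_zero_iff_of_lt_of_lt
    (by linarith [hα.1, hβ.2]) (by linarith [hα.2, hβ.1])).mp hsin
  linarith

/-- The residual network of the MBSL cannot be cancelled by any nontrivial
choice of homodyne measurement angles in `(−π/2, π/2]` together with an
orthogonal post-processing of the outcomes. -/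
theorem mbsl_residual_not_cancellable :
    ¬ ∃ (θ θ' : Fin 4 → ℝ) (R' : Matrix (Fin 4) (Fin 4) ℝ),
      (∀ j, θ j ∈ Set.Ioc (-(Real.pi / 2)) (Real.pi / 2)) ∧
      (∀ j, θ' j ∈ Set.Ioc (-(Real.pi / 2)) (Real.pi / 2)) ∧
      (∃ j k : Fin 4, θ j ≠ θ k) ∧
      R'ᵀ * R' = 1 ∧
      Matrix.diagonal (fun j => Complex.exp ((θ j : ℂ) * Complex.I)) *
          Rres.map (fun x : ℝ => (x : ℂ)) =
        R'.map (fun x : ℝ => (x : ℂ)) *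
          Matrix.diagonal (fun j => Complex.exp ((θ' j : ℂ) * Complex.I)) := by
  rintro ⟨θ, θ', R', hθ, hθ', ⟨j, k, hjk⟩, -, h⟩
  have key (i : Fin 4) : θ i = θ' 0 := by
    refine eq_of_exp_mul_ofReal_eq (r' := R' i 0) (hθ i) (hθ' 0) (Rres_apply_zero_ne_zero i) ?_
    simpa [Matrix.diagonal_mul, Matrix.mul_diagonal] using congrFun (congrFun h i) 0
  exact hjk ((key j).trans (key k).symm)
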